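/- arXiv:2009.13665 — 8 statements merged into one kernel-verified Lean document; each statement's English description precedes it below -/
import Mathlib

section
/- Let E be a finite-dimensional real inner product space, let s* < s** be real numbers, and let f : ℝ → ℝ be continuous. Let J : ℝ → E be twice continuously differentiable and satisfy ⟪J''(t), J(t)⟫ ≥ −f(t)·‖J(t)‖² for every t ∈ [s*, s**]. Let u : ℝ → ℝ be twice continuously differentiable with u''(t) + f(t)·u(t) = 0 for all t ∈ [s*, s**], with u(s*) = ‖J(s*)‖ > 0, u'(s*) ≤ ⟪J'(s*), J(s*)⟫ / ‖J(s*)‖, and u(t) > 0 for all t ∈ (s*, s**]. Then for every t ∈ (s*, s**] one has J(t) ≠ 0 and ⟪J'(t), J(t)⟫ / ‖J(t)‖² ≥ u'(t)/u(t). -/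
open scoped RealInnerProductSpace

/-- A function with nonnegative derivative at every point of `[a, b]` is monotone on `[a, b]`. -/
lemma monotoneOn_Icc_of_hasDerivAt_nonneg {g g' : ℝ → ℝ} {a b : ℝ}
    (hg : ∀ t ∈ Set.Icc a b, HasDerivAt g (g' t) t) (hg' : ∀ t ∈ Set.Icc a b, 0 ≤ g' t) :
    MonotoneOn g (Set.Icc a b) :=
  monotoneOn_of_hasDerivWithinAt_nonneg (convex_Icc a b)
    (fun t ht => (hg t ht).continuousAt.continuousWithinAt)
    (fun t ht => (hg t (interior_subset ht)).hasDerivWithinAt)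
    (fun t ht => hg' t (interior_subset ht))

/-- A `C²` function is differentiable, and so is its derivative. -/
lemma ContDiff.hasDerivAt_and_hasDerivAt_deriv {F : Type*} [NormedAddCommGroup F]
    [NormedSpace ℝ F] {g : ℝ → F} (hg : ContDiff ℝ 2 g) (t : ℝ) :
    HasDerivAt g (deriv g t) t ∧ HasDerivAt (deriv g) (deriv (deriv g) t) t := by
  have hg' : ContDiff ℝ 1 (deriv g) :=
    (contDiff_succ_iff_deriv.mp (show ContDiff ℝ (1 + 1) g by simpa [one_add_one_eq_two])).2.2
  exact ⟨(hg.differentiable (by norm_num) t).hasDerivAt,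
    (hg'.differentiable (by norm_num) t).hasDerivAt⟩

/-- Gulliver's comparison lemma (Lemma 2.7): if `⟪J'', J⟫ ≥ -f‖J‖²` on `[s*, s**]` and `u` solves
`u'' + f u = 0` with matching initial data and stays positive on `(s*, s**]`, then `J` does not
vanish on `(s*, s**]` and `μ_J(t) ≥ u'(t)/u(t)` there. -/
theorem comparison_lemma
    {E : Type*} [NormedAddCommGroup E] [InnerProductSpace ℝ E] [FiniteDimensional ℝ E]
    (sstar sstarstar : ℝ) (hss : sstar < sstarstar)
    (f : ℝ → ℝ) (hf : Continuous f)
    (J : ℝ → E) (hJ : ContDiff ℝ 2 J)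
    (hJineq : ∀ t ∈ Set.Icc sstar sstarstar,
      ⟪deriv (deriv J) t, J t⟫ ≥ -f t * ‖J t‖ ^ 2)
    (u : ℝ → ℝ) (hu : ContDiff ℝ 2 u)
    (hueq : ∀ t ∈ Set.Icc sstar sstarstar, deriv (deriv u) t + f t * u t = 0)
    (hu0 : u sstar = ‖J sstar‖) (hJ0 : 0 < ‖J sstar‖)
    (hu'0 : deriv u sstar ≤ ⟪deriv J sstar, J sstar⟫ / ‖J sstar‖)
    (hupos : ∀ t ∈ Set.Ioc sstar sstarstar, 0 < u t) :
    ∀ t ∈ Set.Ioc sstar sstarstar,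
      J t ≠ 0 ∧ ⟪deriv J t, J t⟫ / ‖J t‖ ^ 2 ≥ deriv u t / u t := by
  have hpos : ∀ t ∈ Set.Icc sstar sstarstar, 0 < u t := fun t ht => by
    rcases ht.1.eq_or_lt with rfl | h
    · exact hu0 ▸ hJ0
    · exact hupos t ⟨h, ht.2⟩
  have hmem : sstar ∈ Set.Icc sstar sstarstar := Set.left_mem_Icc.mpr hss.le
  -- `w = ⟪J', J⟫ - (u'/u) ‖J‖²` has derivative `⟪J'', J⟫ + f ‖J‖² + ‖J' - (u'/u) J‖²`.
  let w : ℝ → ℝ := fun t => ⟪deriv J t, J t⟫ - deriv u t / u t * ⟪J t, J t⟫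
  have hw : ∀ t ∈ Set.Icc sstar sstarstar, HasDerivAt w (⟪deriv (deriv J) t, J t⟫ +
      f t * ‖J t‖ ^ 2 + ‖deriv J t - (deriv u t / u t) • J t‖ ^ 2) t := fun t ht => by
    obtain ⟨hJ1, hJ2⟩ := hJ.hasDerivAt_and_hasDerivAt_deriv t
    obtain ⟨hu1, hu2⟩ := hu.hasDerivAt_and_hasDerivAt_deriv t
    have hut := (hpos t ht).ne'
    refine ((hJ2.inner ℝ hJ1).sub ((hu2.div hu1 hut).mul (hJ1.inner ℝ hJ1))).congr_deriv ?_
    rw [eq_neg_of_add_eq_zero_left (hueq t ht), norm_sub_sq_real, norm_smul, inner_smul_right,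
      mul_pow, Real.norm_eq_abs, sq_abs, real_inner_self_eq_norm_sq, real_inner_self_eq_norm_sq,
      real_inner_comm (deriv J t) (J t)]
    simp only [Pi.div_apply]
    field_simp
    ring
  have hw0 : 0 ≤ w sstar := by
    have h := (le_div_iff₀ hJ0).mp hu'0
    simp only [w, real_inner_self_eq_norm_sq, hu0]
    have h2 : deriv u sstar / ‖J sstar‖ * ‖J sstar‖ ^ 2 = deriv u sstar * ‖J sstar‖ := by
      field_simp
    linarith
  have hw_nonneg : ∀ t ∈ Set.Icc sstar sstarstar, 0 ≤ w t := fun t ht =>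
    hw0.trans <| monotoneOn_Icc_of_hasDerivAt_nonneg hw (fun s hs => by
      linarith [hJineq s hs, sq_nonneg ‖deriv J s - (deriv u s / u s) • J s‖]) hmem ht ht.1
  -- `‖J‖² / u²` has derivative `2 w / u²`.
  have hg : ∀ t ∈ Set.Icc sstar sstarstar,
      HasDerivAt (fun t => ⟪J t, J t⟫ / u t ^ 2) (2 * w t / u t ^ 2) t := fun t ht => by
    have hJ1 := (hJ.hasDerivAt_and_hasDerivAt_deriv t).1
    have hu1 := (hu.hasDerivAt_and_hasDerivAt_deriv t).1
    have hut := (hpos t ht).ne'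
    refine ((hJ1.inner ℝ hJ1).div (hu1.pow 2) (pow_ne_zero 2 hut)).congr_deriv ?_
    simp only [w, real_inner_comm (deriv J t) (J t), Pi.pow_apply]
    field_simp
    ring
  have hg_mono := monotoneOn_Icc_of_hasDerivAt_nonneg hg
    (fun t ht => div_nonneg (mul_nonneg zero_le_two (hw_nonneg t ht)) (sq_nonneg _))
  intro t ht
  have ht' := Set.Ioc_subset_Icc_self ht
  have hJt : J t ≠ 0 := fun h => by
    have hle := hg_mono hmem ht' ht'.1
    simp only [h, inner_zero_left, zero_div, real_inner_self_eq_norm_sq, hu0] at hle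
    exact absurd hle (not_le.mpr (by positivity))
  refine ⟨hJt, ?_⟩
  rw [ge_iff_le, le_div_iff₀ (by positivity), ← real_inner_self_eq_norm_sq]
  exact sub_nonneg.mp (hw_nonneg t ht')
end

section
/- Let E be a finite-dimensional real inner product space, let λ₀ > 0, and let A : E → E be a self-adjoint linear map satisfying ⟪A X, X⟫ ≥ λ₀·‖X‖² for every X ∈ E. Then for all X, Y ∈ E one has ⟪A X, X⟫·⟪A Y, Y⟫ − ⟪A X, Y⟫² ≥ λ₀²·(‖X‖²·‖Y‖² − ⟪X, Y⟫²). -/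
open scoped RealInnerProductSpace

/-- The mixed discriminant of two positive semidefinite binary quadratic forms is nonnegative. -/
theorem two_mul_mul_le_of_sq_le_mul {a b c p q r : ℝ} (ha : 0 ≤ a) (hb : 0 ≤ b) (hp : 0 ≤ p)
    (hq : 0 ≤ q) (hc : c ^ 2 ≤ a * b) (hr : r ^ 2 ≤ p * q) :
    2 * (r * c) ≤ p * b + q * a := by
  refine le_of_abs_le (abs_le_of_sq_le_sq ?_ (by positivity))
  have h : r ^ 2 * c ^ 2 ≤ p * q * (a * b) := by gcongr
  nlinarith [sq_nonneg (p * b - q * a)]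

/-- Cauchy–Schwarz for the form `⟪T X, Y⟫` of a symmetric operator with nonnegative
quadratic form. -/
theorem LinearMap.IsSymmetric.inner_map_sq_le {E : Type*} [NormedAddCommGroup E]
    [InnerProductSpace ℝ E] {T : E →ₗ[ℝ] E} (hT : T.IsSymmetric)
    (hpos : ∀ X : E, 0 ≤ ⟪T X, X⟫) (X Y : E) :
    ⟪T X, Y⟫ ^ 2 ≤ ⟪T X, X⟫ * ⟪T Y, Y⟫ := by
  have hsymm : ⟪T Y, X⟫ = ⟪T X, Y⟫ := by rw [hT, real_inner_comm]
  have h : discrim ⟪T X, X⟫ (2 * ⟪T X, Y⟫) ⟪T Y, Y⟫ ≤ 0 := by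
    refine discrim_le_zero fun t => ?_
    have ht := hpos (t • X + Y)
    simp only [map_add, map_smul, inner_add_left, inner_add_right, real_inner_smul_left,
      real_inner_smul_right, hsymm] at ht
    linarith
  rw [discrim] at h
  linarith

/-- Linear-algebra core of Lemma 2.9: if a self-adjoint operator `A` satisfies
`⟪A X, X⟫ ≥ λ₀‖X‖²`, then `II(X,X)·II(Y,Y) − II(X,Y)² ≥ λ₀²·|X ∧ Y|²`. -/
theorem second_fundamental_form_bound
    {E : Type*} [NormedAddCommGroup E] [InnerProductSpace ℝ E] [FiniteDimensional ℝ E]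
    (lam : ℝ) (hlam : 0 < lam) (A : E →ₗ[ℝ] E) (hA : A.IsSymmetric)
    (hpos : ∀ X : E, lam * ‖X‖ ^ 2 ≤ ⟪A X, X⟫) (X Y : E) :
    lam ^ 2 * (‖X‖ ^ 2 * ‖Y‖ ^ 2 - ⟪X, Y⟫ ^ 2)
      ≤ ⟪A X, X⟫ * ⟪A Y, Y⟫ - ⟪A X, Y⟫ ^ 2 := by
  have happly (Z W : E) : ⟪(A - lam • (LinearMap.id : E →ₗ[ℝ] E)) Z, W⟫ = ⟪A Z, W⟫ - lam * ⟪Z, W⟫ := by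
    simp [inner_sub_left, real_inner_smul_left]
  have hB : (A - lam • (LinearMap.id : E →ₗ[ℝ] E)).IsSymmetric :=
    hA.sub (LinearMap.IsSymmetric.id.smul (by simp))
  have hBpos (Z : E) : 0 ≤ ⟪(A - lam • (LinearMap.id : E →ₗ[ℝ] E)) Z, Z⟫ := by
    rw [happly, real_inner_self_eq_norm_sq]
    linarith [hpos Z]
  have hc := hB.inner_map_sq_le hBpos X Y
  have hr : ⟪X, Y⟫ ^ 2 ≤ ‖X‖ ^ 2 * ‖Y‖ ^ 2 := by
    rw [← mul_pow]
    exact sq_le_sq' (neg_le_of_abs_le (abs_real_inner_le_norm X Y)) (real_inner_le_norm X Y)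
  have hmix := two_mul_mul_le_of_sq_le_mul (hBpos X) (hBpos Y) (sq_nonneg ‖X‖) (sq_nonneg ‖Y‖) hc hr
  simp only [happly, real_inner_self_eq_norm_sq] at hc hmix
  linarith [mul_le_mul_of_nonneg_left hmix hlam.le]
end

section
/- Let λ > 0, let ℓ > 2λ, and let t ≥ 0. Set E = e^{ℓt} and c = ℓ/(2λ) − 1 (so c > 0). Then −(ℓ²/2)·(E/(c + E)) + (ℓ²/4)·(E/(c + E))² ≤ −ℓλ + λ². -/
/-- Key computation in Proposition 5.3(2): with `E = e^{ℓt}` and `c = ℓ/(2λ) − 1`,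
`−(ℓ²/2)·E/(c+E) + (ℓ²/4)·(E/(c+E))² ≤ −ℓλ + λ²`. -/
theorem orthogonal_curvature_upper_bound
    (lam ℓ t : ℝ) (hlam : 0 < lam) (hl : 2 * lam < ℓ) (ht : 0 ≤ t) :
    -(ℓ ^ 2 / 2) * (Real.exp (ℓ * t) / ((ℓ / (2 * lam) - 1) + Real.exp (ℓ * t)))
        + (ℓ ^ 2 / 4) * (Real.exp (ℓ * t) / ((ℓ / (2 * lam) - 1) + Real.exp (ℓ * t))) ^ 2
      ≤ -(ℓ * lam) + lam ^ 2 := by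
  have hℓ : 0 < ℓ := by linarith
  have hc : 0 < ℓ / (2 * lam) - 1 := by
    rw [sub_pos, one_lt_div (by positivity)]
    exact hl
  have hE : 1 ≤ Real.exp (ℓ * t) := Real.one_le_exp (by positivity)
  have hcE : 0 < ℓ / (2 * lam) - 1 + Real.exp (ℓ * t) := by linarith
  have hx_le : Real.exp (ℓ * t) / (ℓ / (2 * lam) - 1 + Real.exp (ℓ * t)) ≤ 1 := by
    rw [div_le_one hcE]
    linarith
  have hle_x : 2 * lam ≤ ℓ * (Real.exp (ℓ * t) / (ℓ / (2 * lam) - 1 + Real.exp (ℓ * t))) := by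
    rw [← mul_div_assoc, le_div_iff₀ hcE]
    have hcancel : 2 * lam * (ℓ / (2 * lam)) = ℓ := by field_simp
    nlinarith [mul_nonneg (sub_nonneg.2 hl.le) (sub_nonneg.2 hE)]
  generalize Real.exp (ℓ * t) / (ℓ / (2 * lam) - 1 + Real.exp (ℓ * t)) = x at hx_le hle_x ⊢
  have hx_le' : ℓ * x ≤ ℓ := mul_le_of_le_one_right hℓ.le hx_le
  have hprod : 0 ≤ (ℓ * x - 2 * lam) * (2 * ℓ - 2 * lam - ℓ * x) :=
    mul_nonneg (by linarith) (by linarith)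
  linarith
end

section
/- Let κ₀ > 0, Q ≥ 0, and let 0 < τ ≤ 1/(κ₀ + (Q+1)²). Let μ : ℝ → ℝ be differentiable on [0, τ] with μ'(t) ≥ −κ₀ − μ(t)² for all t ∈ [0, τ]. Then: (i) if μ(0) ≥ −Q, then μ(t) > −(Q+1) for all t ∈ [0, τ], and ∫₀^τ μ(t) dt ≥ −1/(Q+1); (ii) if μ(0) > Q + 1, then μ(t) > Q for all t ∈ [0, τ]. -/
/-- A strict lower barrier for a function on `[0, τ]` satisfying `μ' ≥ -κ - μ²`. -/
theorem le_of_strict_riccati_subsolution {κ τ : ℝ} {μ L L' : ℝ → ℝ}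
    (hdiff : DifferentiableOn ℝ μ (Set.Icc 0 τ))
    (hineq : ∀ t ∈ Set.Icc 0 τ, derivWithin μ (Set.Icc 0 τ) t ≥ -κ - μ t ^ 2)
    (hL : ∀ t, HasDerivAt L (L' t) t) (h0 : L 0 ≤ μ 0)
    (hlt : ∀ t ∈ Set.Ico 0 τ, L t = μ t → L' t < -κ - L t ^ 2) :
    ∀ t ∈ Set.Icc 0 τ, L t ≤ μ t := by
  intro t ht
  refine image_le_of_deriv_right_lt_deriv_boundary' (f' := L')
    (B' := fun x => derivWithin μ (Set.Icc 0 τ) x)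
    (fun x _ => (hL x).continuousAt.continuousWithinAt)
    (fun x _ => (hL x).hasDerivWithinAt) h0 hdiff.continuousOn ?_ ?_ ht
  · intro x hx
    exact ((hdiff x (Set.Ico_subset_Icc_self hx)).hasDerivWithinAt).mono_of_mem_nhdsWithin
      (Icc_mem_nhdsGE_of_mem hx)
  · intro x hx hxe
    have h := hineq x (Set.Ico_subset_Icc_self hx)
    have h' := hlt x hx hxe
    rw [hxe] at h'
    exact h'.trans_le h


/-- Scalar Riccati comparison from Lemma 8.4: if `μ' ≥ −κ₀ − μ²` on `[0, τ]` with
`τ ≤ 1/(κ₀ + (Q+1)²)`, then (i) `μ(0) ≥ −Q` implies `μ > −(Q+1)` on `[0, τ]` and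
`∫₀^τ μ ≥ −1/(Q+1)`; (ii) `μ(0) > Q+1` implies `μ > Q` on `[0, τ]`. -/
theorem riccati_comparison_collar
    (κ Q τ : ℝ) (hκ : 0 < κ) (hQ : 0 ≤ Q) (hτ0 : 0 < τ)
    (hτ : τ ≤ 1 / (κ + (Q + 1) ^ 2))
    (μ : ℝ → ℝ) (hdiff : DifferentiableOn ℝ μ (Set.Icc 0 τ))
    (hineq : ∀ t ∈ Set.Icc 0 τ, derivWithin μ (Set.Icc 0 τ) t ≥ -κ - μ t ^ 2) :
    (μ 0 ≥ -Q → (∀ t ∈ Set.Icc 0 τ, μ t > -(Q + 1)) ∧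
      (∫ t in (0:ℝ)..τ, μ t) ≥ -(1 / (Q + 1))) ∧
    (μ 0 > Q + 1 → ∀ t ∈ Set.Icc 0 τ, μ t > Q) := by
  set C := κ + (Q + 1) ^ 2 with hC
  have hC1 : 1 < C := by nlinarith
  have hC0 : 0 < C := by linarith
  have hCτ : C * τ ≤ 1 := by
    rw [le_div_iff₀ hC0] at hτ
    linarith
  refine ⟨fun h0 => ?_, fun h0 t ht => ?_⟩
  · have hlow : ∀ t ∈ Set.Icc 0 τ, μ t > -(Q + 1) := by
      intro t ht
      have hCt : C * t ≤ 1 := (mul_le_mul_of_nonneg_left ht.2 hC0.le).trans hCτ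
      have hbarrier := le_of_strict_riccati_subsolution
        (L := fun t => -Q - C * t + (t - C * t ^ 2 / 2) / 2)
        (L' := fun t => -C + (1 - C * t) / 2) hdiff hineq
        (fun x => by
          have h := (((hasDerivAt_id x).const_mul C).const_sub (-Q)).add
            (((hasDerivAt_id x).sub
              ((((hasDerivAt_id x).pow 2).const_mul C).div_const 2)).div_const 2)
          refine h.congr_deriv ?_
          simp
          ring)
        (by simpa using h0)
        (fun x hx _ => by
          have hx0 := hx.1
          have hCx : C * x < 1 := (mul_lt_mul_of_pos_left hx.2 hC0).trans_le hCτ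
          have hxC : x ≤ C * x := by nlinarith
          have hφ0 : 0 ≤ x - C * x ^ 2 / 2 := by nlinarith
          have hφ1 : x - C * x ^ 2 / 2 ≤ C * x := by nlinarith [mul_nonneg hC0.le (sq_nonneg x)]
          have hsq : (-Q - C * x + (x - C * x ^ 2 / 2) / 2) ^ 2 ≤ (Q + C * x) ^ 2 := by
            apply sq_le_sq' <;> linarith
          nlinarith [mul_nonneg hQ (sub_nonneg.2 hCx.le), mul_nonneg hC0.le hx0,
            mul_nonneg (mul_nonneg hC0.le hx0) (sub_nonneg.2 hCx.le)])
        t ht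
      rcases ht.1.eq_or_lt with rfl | htpos
      · linarith
      · nlinarith
    refine ⟨hlow, ?_⟩
    have hint : IntervalIntegrable μ MeasureTheory.volume 0 τ :=
      hdiff.continuousOn.intervalIntegrable_of_Icc hτ0.le
    have hmono := intervalIntegral.integral_mono_on hτ0.le
      (intervalIntegrable_const (c := -(Q + 1))) hint (fun t ht => (hlow t ht).le)
    rw [intervalIntegral.integral_const, smul_eq_mul] at hmono
    have hle : (Q + 1) * τ ≤ 1 / (Q + 1) := by
      rw [le_div_iff₀ (by linarith)]
      nlinarith
    linarith
  · have hCt : C * t ≤ 1 := (mul_le_mul_of_nonneg_left ht.2 hC0.le).trans hCτ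
    have hbarrier := le_of_strict_riccati_subsolution
      (L := fun t => Q + 1 - C * t + t ^ 2 / 4)
      (L' := fun t => -C + t / 2) hdiff hineq
      (fun x => by
        have h := (((hasDerivAt_id x).const_mul C).const_sub (Q + 1)).add
          (((hasDerivAt_id x).pow 2).div_const 4)
        refine h.congr_deriv ?_
        simp
        ring)
      (by simpa using h0.le)
      (fun x hx hxe => by
        rcases hx.1.eq_or_lt with rfl | hx0
        · simp at hxe
          linarith
        have hCx : C * x < 1 := (mul_lt_mul_of_pos_left hx.2 hC0).trans_le hCτ
        have hxC : x < C * x := by nlinarith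
        have hd : 3 * x / 4 ≤ C * x - x ^ 2 / 4 := by nlinarith
        have hd1 : C * x - x ^ 2 / 4 ≤ 1 := by nlinarith
        generalize hδ : C * x - x ^ 2 / 4 = δ at hd hd1
        have hL : Q + 1 - C * x + x ^ 2 / 4 = Q + 1 - δ := by linarith
        simp only [hL]
        have hδ0 : 0 ≤ δ := by linarith
        nlinarith [mul_nonneg hQ hδ0, mul_nonneg hδ0 (sub_nonneg.2 hd1)])
      t ht
    rcases ht.1.eq_or_lt with rfl | htpos
    · linarith
    · nlinarith [sq_pos_of_pos htpos]
end

section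
/- Let λ > 0 and t₀ ≤ τ be real numbers, and let d : ℝ → ℝ be twice continuously differentiable such that |d'(s)| < 1 and d''(s) ≥ λ·(1 − d'(s)²) for all s ∈ [t₀, τ], and d'(t₀) ≥ 0. Then for every s ∈ [t₀, τ]: d'(s) ≥ tanh(λ·(s − t₀)) and d(s) ≥ d(t₀) + (1/λ)·ln(cosh(λ·(s − t₀))). -/
/-- A function whose derivative is nonnegative on `[a, b]` takes its least value at `a`. -/
theorem le_of_hasDerivAt_nonneg_Icc {f f' : ℝ → ℝ} {a b : ℝ}
    (hf : ∀ x, HasDerivAt f (f' x) x) (hf' : ∀ x ∈ Set.Icc a b, 0 ≤ f' x) :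
    ∀ x ∈ Set.Icc a b, f a ≤ f x := by
  have hmono : MonotoneOn f (Set.Icc a b) :=
    monotoneOn_of_hasDerivWithinAt_nonneg (convex_Icc a b)
      (fun x _ => (hf x).continuousAt.continuousWithinAt)
      (fun x _ => (hf x).hasDerivWithinAt)
      (fun x hx => hf' x (interior_subset hx))
  exact fun x hx => hmono ⟨le_rfl, hx.1.trans hx.2⟩ hx hx.1

/-- ODE estimate from Lemma 8.4: if `|d'| < 1`, `d'' ≥ λ(1 − (d')²)` on `[t₀, τ]` and
`d'(t₀) ≥ 0`, then `d'(s) ≥ tanh(λ(s − t₀))` and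
`d(s) ≥ d(t₀) + (1/λ)·ln(cosh(λ(s − t₀)))` for all `s ∈ [t₀, τ]`. -/
theorem convexity_ode_estimate
    (lam t₀ τ : ℝ) (hlam : 0 < lam) (ht : t₀ ≤ τ)
    (d : ℝ → ℝ) (hd : ContDiff ℝ 2 d)
    (hd' : ∀ s ∈ Set.Icc t₀ τ, |deriv d s| < 1)
    (hd'' : ∀ s ∈ Set.Icc t₀ τ, deriv (deriv d) s ≥ lam * (1 - (deriv d s) ^ 2))
    (hd'0 : deriv d t₀ ≥ 0) :
    ∀ s ∈ Set.Icc t₀ τ,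
      deriv d s ≥ Real.tanh (lam * (s - t₀)) ∧
      d s ≥ d t₀ + (1 / lam) * Real.log (Real.cosh (lam * (s - t₀))) := by
  have hd1 : ∀ x, HasDerivAt d (deriv d x) x := fun x =>
    (hd.differentiable (by norm_num) x).hasDerivAt
  have hd2 : ∀ x, HasDerivAt (deriv d) (deriv (deriv d) x) x := fun x =>
    ((hd.deriv' (n := 1)).differentiable (by norm_num) x).hasDerivAt
  have hlin : ∀ x, HasDerivAt (fun s => lam * (s - t₀)) lam x := fun x => by
    simpa using ((hasDerivAt_id x).sub_const t₀).const_mul lam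
  have htanh : ∀ s ∈ Set.Icc t₀ τ, Real.tanh (lam * (s - t₀)) ≤ deriv d s := by
    intro s hs
    -- `exp (lam * d)` is an integrating factor for the defect `cosh * d' - sinh`.
    have key := le_of_hasDerivAt_nonneg_Icc (a := t₀) (b := τ)
      (fun x => ((hd1 x).const_mul lam).exp.mul
        (((hlin x).cosh.mul (hd2 x)).sub (hlin x).sinh)) (fun x hx => by
        have hmul := mul_nonneg (Real.exp_pos (lam * d x)).le
          (mul_nonneg (Real.cosh_pos (lam * (x - t₀))).le (sub_nonneg.2 (hd'' x hx)))
        dsimp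
        linarith) s hs
    have hdefect : 0 ≤ Real.exp (lam * d s) *
        (Real.cosh (lam * (s - t₀)) * deriv d s - Real.sinh (lam * (s - t₀))) :=
      le_trans (by simpa using mul_nonneg (Real.exp_pos (lam * d t₀)).le hd'0) key
    have := nonneg_of_mul_nonneg_right hdefect (Real.exp_pos _)
    rw [Real.tanh_eq_sinh_div_cosh, div_le_iff₀ (Real.cosh_pos _)]
    linarith
  refine fun s hs => ⟨htanh s hs, ?_⟩
  have key := le_of_hasDerivAt_nonneg_Icc (a := t₀) (b := τ)
    (fun x => (hd1 x).sub
      (((hlin x).cosh.log (Real.cosh_pos _).ne').const_mul (1 / lam))) (fun x hx => by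
      have h := htanh x hx
      rw [Real.tanh_eq_sinh_div_cosh] at h
      have hcancel : 1 / lam * (Real.sinh (lam * (x - t₀)) * lam / Real.cosh (lam * (x - t₀))) =
          Real.sinh (lam * (x - t₀)) / Real.cosh (lam * (x - t₀)) := by
        field_simp
      rw [hcancel]
      linarith) s hs
  simp only [Pi.sub_apply, sub_self, mul_zero, Real.cosh_zero, Real.log_one, sub_zero] at key
  linarith
end

section
/- Let λ > 0 and t₀ ≤ τ, and let d : ℝ → ℝ be twice continuously differentiable with |d'(s)| < 1 and d''(s) ≥ λ·(1 − d'(s)²) for all s ∈ [t₀, τ], and d'(t₀) ≥ 0. Suppose moreover that there exist b₊ ∈ ℝ and c > 0 with d(s) ≤ b₊ for all s ∈ [t₀, τ] and b₊ − d(t₀) < (1/λ)·ln(cosh(λ·c)). Then τ − t₀ < c. -/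
/-- A function with `u'' ≥ k² u` on `[a, b]` and `u' a ≥ 0` satisfies
`u b ≥ u a * cosh (k (b - a))`. -/
theorem mul_cosh_le_of_sq_mul_le_second_deriv {k a b : ℝ} (hab : a ≤ b) {u u' u'' : ℝ → ℝ}
    (hu : ∀ s ∈ Set.Icc a b, HasDerivAt u (u' s) s)
    (hu' : ∀ s ∈ Set.Icc a b, HasDerivAt u' (u'' s) s)
    (hu'' : ∀ s ∈ Set.Icc a b, k ^ 2 * u s ≤ u'' s) (h₀ : 0 ≤ u' a) :
    u a * Real.cosh (k * (b - a)) ≤ u b := by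
  have hlin (s : ℝ) : HasDerivAt (fun s ↦ k * (s - a)) k s := by
    simpa using ((hasDerivAt_id s).sub_const a).const_mul k
  have hwronskian : MonotoneOn
      (fun s ↦ u' s * Real.cosh (k * (s - a)) - k * (u s * Real.sinh (k * (s - a))))
      (Set.Icc a b) := by
    have hderiv (s : ℝ) (hs : s ∈ Set.Icc a b) : HasDerivAt
        (fun s ↦ u' s * Real.cosh (k * (s - a)) - k * (u s * Real.sinh (k * (s - a))))
        ((u'' s - k ^ 2 * u s) * Real.cosh (k * (s - a))) s := by
      refine (((hu' s hs).fun_mul (hlin s).cosh).fun_sub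
        (((hu s hs).fun_mul (hlin s).sinh).const_mul k)).congr_deriv ?_
      ring
    refine monotoneOn_of_hasDerivWithinAt_nonneg (convex_Icc a b)
      (fun s hs ↦ (hderiv s hs).continuousAt.continuousWithinAt)
      (fun s hs ↦ (hderiv s (interior_subset hs)).hasDerivWithinAt) fun s hs ↦ ?_
    exact mul_nonneg (sub_nonneg.2 (hu'' s (interior_subset hs))) (Real.cosh_pos _).le
  have hquotient : MonotoneOn (fun s ↦ u s / Real.cosh (k * (s - a))) (Set.Icc a b) := by
    have hderiv (s : ℝ) (hs : s ∈ Set.Icc a b) :=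
      (hu s hs).fun_div (hlin s).cosh (Real.cosh_pos _).ne'
    refine monotoneOn_of_hasDerivWithinAt_nonneg (convex_Icc a b)
      (fun s hs ↦ (hderiv s hs).continuousAt.continuousWithinAt)
      (fun s hs ↦ (hderiv s (interior_subset hs)).hasDerivWithinAt) fun s hs ↦ ?_
    have hs := interior_subset hs
    have hle := hwronskian (Set.left_mem_Icc.2 hab) hs hs.1
    simp only [sub_self, mul_zero, Real.cosh_zero, Real.sinh_zero, mul_one, sub_zero] at hle
    exact div_nonneg (by linarith) (sq_nonneg _)
  have hle := hquotient (Set.left_mem_Icc.2 hab) (Set.right_mem_Icc.2 hab) hab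
  simp only [sub_self, mul_zero, Real.cosh_zero, div_one] at hle
  exact (le_div_iff₀ (Real.cosh_pos _)).1 hle

/-- Travel-time estimate from Lemma 8.4: under the convexity differential inequality, if
`d ≤ b₊` on `[t₀, τ]` and `b₊ − d(t₀) < (1/λ)·ln cosh(λc)`, then `τ − t₀ < c`. -/
theorem travel_time_estimate
    (lam t₀ τ : ℝ) (hlam : 0 < lam) (ht : t₀ ≤ τ)
    (d : ℝ → ℝ) (hd : ContDiff ℝ 2 d)
    (hd' : ∀ s ∈ Set.Icc t₀ τ, |deriv d s| < 1)
    (hd'' : ∀ s ∈ Set.Icc t₀ τ, deriv (deriv d) s ≥ lam * (1 - (deriv d s) ^ 2))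
    (hd'0 : deriv d t₀ ≥ 0)
    (bplus c : ℝ) (hc : 0 < c)
    (hbound : ∀ s ∈ Set.Icc t₀ τ, d s ≤ bplus)
    (hwidth : bplus - d t₀ < (1 / lam) * Real.log (Real.cosh (lam * c))) :
    τ - t₀ < c := by
  have hd₁ (s : ℝ) : HasDerivAt d (deriv d s) s :=
    (hd.differentiable (by norm_num) s).hasDerivAt
  have hd₂ (s : ℝ) : HasDerivAt (deriv d) (deriv (deriv d) s) s :=
    ((hd.deriv' (n := 1)).differentiable (by norm_num) s).hasDerivAt
  have hexp (s : ℝ) := ((hd₁ s).const_mul lam).exp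
  have hgrowth := mul_cosh_le_of_sq_mul_le_second_deriv (k := lam) ht
    (fun s _ ↦ hexp s) (fun s _ ↦ (hexp s).fun_mul ((hd₂ s).const_mul lam))
    (fun s hs ↦ by
      have := mul_le_mul_of_nonneg_left (hd'' s hs)
        (mul_nonneg hlam.le (Real.exp_pos (lam * d s)).le)
      linarith)
    (mul_nonneg (Real.exp_pos _).le (mul_nonneg hlam.le hd'0))
  have hupper : Real.exp (lam * d t₀) * Real.cosh (lam * (τ - t₀)) ≤
      Real.exp (lam * bplus) :=
    hgrowth.trans (Real.exp_le_exp.2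
      (mul_le_mul_of_nonneg_left (hbound τ (Set.right_mem_Icc.2 ht)) hlam.le))
  have hlower : Real.exp (lam * bplus) < Real.exp (lam * d t₀) * Real.cosh (lam * c) := by
    rw [one_div_mul_eq_div, lt_div_iff₀ hlam] at hwidth
    rw [← Real.exp_log (Real.cosh_pos (lam * c)), ← Real.exp_add, Real.exp_lt_exp]
    linarith
  have hcosh := lt_of_mul_lt_mul_left (hupper.trans_lt hlower) (Real.exp_pos _).le
  rw [Real.cosh_lt_cosh, abs_of_nonneg (mul_nonneg hlam.le (sub_nonneg.2 ht)),
    abs_of_pos (mul_pos hlam hc)] at hcosh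
  exact lt_of_mul_lt_mul_left hcosh hlam.le
end

section
/- Let a > 0, 0 ≤ c < a, and T > 0. Let μ : ℝ → ℝ be differentiable on [0, T] with μ'(t) ≥ a² − μ(t)² for all t ∈ [0, T] and μ(0) ≥ −c. Then μ(t) ≥ a·tanh(a·t − artanh(c/a)) for all t ∈ [0, T]; in particular μ(t) ≥ −c for all t ∈ [0, T], and μ(t) ≥ c whenever t ∈ [0, T] satisfies t ≥ (2/a)·artanh(c/a). -/
/-- The inverse hyperbolic tangent. -/
noncomputable def artanh (x : ℝ) : ℝ := (1 / 2) * Real.log ((1 + x) / (1 - x))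

/-- A linear differential inequality `w' ≥ -p w` preserves nonnegativity of the initial value. -/
theorem nonneg_of_derivWithin_ge_neg_mul {T : ℝ} {w p : ℝ → ℝ}
    (hw : DifferentiableOn ℝ w (Set.Icc 0 T)) (hp : ContinuousOn p (Set.Icc 0 T))
    (hineq : ∀ t ∈ Set.Icc 0 T, -(p t * w t) ≤ derivWithin w (Set.Icc 0 T) t)
    (h0 : 0 ≤ w 0) {t : ℝ} (ht : t ∈ Set.Icc 0 T) : 0 ≤ w t := by
  have hT : (0 : ℝ) ≤ T := ht.1.trans ht.2
  set q : ℝ → ℝ := Set.IccExtend hT ((Set.Icc 0 T).domRestrict p) with hq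
  have hqc : Continuous q := (continuousOn_iff_continuous_domRestrict.1 hp).Icc_extend'
  have hqp : ∀ s ∈ Set.Icc 0 T, q s = p s := fun s hs => by
    rw [hq, Set.IccExtend_of_mem _ _ hs, Set.domRestrict_apply]
  have hE : ∀ s, HasDerivAt (fun s => Real.exp (∫ u in (0 : ℝ)..s, q u))
      (Real.exp (∫ u in (0 : ℝ)..s, q u) * q s) s := fun s =>
    (hqc.integral_hasStrictDerivAt 0 s).hasDerivAt.exp
  have hder : ∀ s ∈ Set.Icc 0 T, HasDerivWithinAt
      (fun s => Real.exp (∫ u in (0 : ℝ)..s, q u) * w s) _ (Set.Icc 0 T) s := fun s hs =>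
    (hE s).hasDerivWithinAt.mul (hw s hs).hasDerivWithinAt
  have hmono : MonotoneOn (fun s => Real.exp (∫ u in (0 : ℝ)..s, q u) * w s) (Set.Icc 0 T) := by
    refine monotoneOn_of_hasDerivWithinAt_nonneg (convex_Icc 0 T)
      (fun s hs => (hder s hs).continuousWithinAt)
      (fun s hs => (hder s (interior_subset hs)).mono interior_subset) fun s hs => ?_
    have hs' := interior_subset hs
    rw [hqp s hs', mul_assoc, ← mul_add]
    exact mul_nonneg (Real.exp_pos _).le (by linarith [hineq s hs'])
  have h := hmono (Set.left_mem_Icc.2 hT) ht ht.1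
  simp only [intervalIntegral.integral_same, Real.exp_zero, one_mul] at h
  exact nonneg_of_mul_nonneg_right (h0.trans h) (Real.exp_pos _)

theorem hasDerivAt_real_tanh (x : ℝ) : HasDerivAt Real.tanh (1 - Real.tanh x ^ 2) x := by
  have hx := (Real.cosh_pos x).ne'
  have h := (Real.hasDerivAt_sinh x).div (Real.hasDerivAt_cosh x) hx
  have heq : Real.tanh = Real.sinh / Real.cosh := funext Real.tanh_eq_sinh_div_cosh
  rw [Real.tanh_eq_sinh_div_cosh, heq]
  refine h.congr_deriv ?_
  field_simp

theorem monotone_real_tanh : Monotone Real.tanh :=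
  monotone_of_hasDerivAt_nonneg hasDerivAt_real_tanh fun x => by
    simpa using (Real.tanh_sq_lt_one x).le

theorem real_tanh_artanh {x : ℝ} (hx : x ∈ Set.Ioo (-1) 1) : Real.tanh (artanh x) = x := by
  rw [artanh, ← Real.artanh_eq_half_log (Set.Ioo_subset_Icc_self hx), Real.tanh_artanh hx]


/-- Scalar Riccati comparison from Lemma 8.6: if `μ' ≥ a² − μ²` on `[0, T]` and `μ(0) ≥ −c`,
then `μ(t) ≥ a·tanh(at − artanh(c/a))` on `[0, T]`; in particular `μ ≥ −c`, and `μ(t) ≥ c`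
once `t ≥ (2/a)·artanh(c/a)`. -/
theorem riccati_comparison_negative_curvature
    (a c T : ℝ) (ha : 0 < a) (hc : 0 ≤ c) (hca : c < a) (hT : 0 < T)
    (μ : ℝ → ℝ) (hdiff : DifferentiableOn ℝ μ (Set.Icc 0 T))
    (hineq : ∀ t ∈ Set.Icc 0 T, derivWithin μ (Set.Icc 0 T) t ≥ a ^ 2 - μ t ^ 2)
    (h0 : μ 0 ≥ -c) :
    (∀ t ∈ Set.Icc 0 T, μ t ≥ a * Real.tanh (a * t - artanh (c / a))) ∧
    (∀ t ∈ Set.Icc 0 T, μ t ≥ -c) ∧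
    (∀ t ∈ Set.Icc 0 T, t ≥ (2 / a) * artanh (c / a) → μ t ≥ c) := by
  have hx : c / a ∈ Set.Ioo (-1) 1 :=
    ⟨by linarith [div_nonneg hc ha.le], (div_lt_one ha).2 hca⟩
  have htanh := real_tanh_artanh hx
  have hac : a * (c / a) = c := mul_div_cancel₀ c ha.ne'
  set b := artanh (c / a)
  set ν : ℝ → ℝ := fun t => a * Real.tanh (a * t - b) with hν
  have hνd : ∀ t, HasDerivAt ν (a ^ 2 - ν t ^ 2) t := fun t => by
    refine (((hasDerivAt_real_tanh (a * t - b)).comp t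
      (((hasDerivAt_id t).const_mul a).sub_const b)).const_mul a).congr_deriv ?_
    simp only [hν]
    ring
  have hmain : ∀ t ∈ Set.Icc 0 T, μ t ≥ ν t := fun t ht => by
    have hν0 : ν 0 = -c := by simp [hν, htanh, hac]
    have hνon : DifferentiableOn ℝ ν (Set.Icc 0 T) := fun s _ =>
      (hνd s).differentiableAt.differentiableWithinAt
    refine sub_nonneg.1 (nonneg_of_derivWithin_ge_neg_mul (w := fun s => μ s - ν s)
      (p := fun s => μ s + ν s) (hdiff.sub hνon)
      (hdiff.continuousOn.add hνon.continuousOn) (fun s hs => ?_) (by linarith) ht)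
    have hd := ((hdiff s hs).hasDerivWithinAt.sub (hνd s).hasDerivWithinAt).derivWithin
      (uniqueDiffOn_Icc hT s hs)
    change _ ≤ derivWithin (μ - ν) _ s
    rw [hd]
    linarith [hineq s hs]
  refine ⟨hmain, fun t ht => ?_, fun t ht htb => ?_⟩
  · have h : Real.tanh (-b) ≤ Real.tanh (a * t - b) :=
      monotone_real_tanh (by linarith [mul_nonneg ha.le ht.1])
    rw [Real.tanh_neg, htanh] at h
    have h' : a * -(c / a) ≤ ν t := mul_le_mul_of_nonneg_left h ha.le
    linarith [hmain t ht]
  · have hb : 2 * b ≤ a * t := by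
      rwa [ge_iff_le, div_mul_eq_mul_div, div_le_iff₀' ha] at htb
    have h : Real.tanh b ≤ Real.tanh (a * t - b) := monotone_real_tanh (by linarith)
    rw [htanh] at h
    have h' : a * (c / a) ≤ ν t := mul_le_mul_of_nonneg_left h ha.le
    linarith [hmain t ht]
end

section
/- For ℓ > 0 define f_ℓ : ℝ → ℝ by f_ℓ(t) = (e^{ℓt} − 1)/ℓ, and for κ ≠ 0 and a, b ∈ ℝ define u_κ : ℝ → ℝ by u_κ(t) = (1/κ²)·(a·sinh(κt) + b·cosh(κt))². Let τ > 0 and a, b ∈ ℝ with a² + b² ≠ 0, and let M > 0. Then there exists L > 0 such that for every ℓ > L there exist κ ∈ ℝ with κ² > M and r ∈ ℝ with r > −τ satisfying f_ℓ(τ) = u_κ(τ + r) and f_ℓ'(τ) = u_κ'(τ + r). -/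
open Real in
/-- A point with prescribed values of the hyperbolic profile and its derivative, provided these are
compatible with the first integral `B ^ 2 - A ^ 2 = a ^ 2 - b ^ 2`. -/
lemma exists_pos_hyperbolic_profile_eq {a b F G κ : ℝ} (hab : a + b ≠ 0) (hF : 0 < F) (hG : 0 < G)
    (hκ : 0 < κ) (hfirst : 4 * F * (κ ^ 2 * F + (a ^ 2 - b ^ 2)) = G ^ 2)
    (hlarge : (a + b) ^ 2 < κ ^ 2 * F) :
    ∃ s > 0, F = (1 / κ ^ 2) * (a * sinh (κ * s) + b * cosh (κ * s)) ^ 2 ∧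
      G = 2 / κ * ((a * sinh (κ * s) + b * cosh (κ * s)) *
        (a * cosh (κ * s) + b * sinh (κ * s))) := by
  obtain ⟨p, hp, rfl⟩ : ∃ p > 0, F = p ^ 2 := ⟨√F, sqrt_pos.2 hF, (sq_sqrt hF.le).symm⟩
  obtain ⟨q, hq, rfl⟩ : ∃ q > 0, G = 2 * p * q := ⟨G / (2 * p), by positivity, by field_simp⟩
  have hpq : (κ * p + q) * (κ * p - q) = (b - a) * (a + b) := by
    have : 4 * p ^ 2 * ((κ * p + q) * (κ * p - q) - (b - a) * (a + b)) = 0 := by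
      linear_combination hfirst
    have := (mul_eq_zero.1 this).resolve_left (by positivity)
    linarith
  have hsum : 0 < κ * p + q := by positivity
  obtain ⟨ε, hε, hεab⟩ : ∃ ε : ℝ, ε ^ 2 = 1 ∧ |a + b| = ε * (a + b) := by
    rcases abs_choice (a + b) with h | h
    · exact ⟨1, by norm_num, by rw [h]; ring⟩
    · exact ⟨-1, by norm_num, by rw [h]; ring⟩
  have habs : 0 < |a + b| := abs_pos.2 hab
  have hE : 1 < (κ * p + q) / |a + b| := by
    rw [one_lt_div habs]
    have : |a + b| < κ * p := abs_lt_of_sq_lt_sq (by nlinarith) (by positivity)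
    linarith
  set E := (κ * p + q) / |a + b| with hEdef
  have hE0 : 0 < E := by linarith
  have hplus : (a + b) * E = ε * (κ * p + q) := by
    have : E * |a + b| = κ * p + q := div_mul_cancel₀ _ habs.ne'
    rw [hεab] at this
    linear_combination ε * this - (a + b) * E * hε
  have hminus : (b - a) * E⁻¹ = ε * (κ * p - q) := by
    rw [← div_eq_mul_inv, div_eq_iff hE0.ne']
    apply mul_right_cancel₀ hab
    linear_combination -hpq - ε * (κ * p - q) * hplus - (κ * p - q) * (κ * p + q) * hε
  have hA : a * sinh (log E) + b * cosh (log E) = ε * κ * p := by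
    rw [sinh_eq, cosh_eq, exp_neg, exp_log hE0]
    linear_combination (hplus + hminus) / 2
  have hB : a * cosh (log E) + b * sinh (log E) = ε * q := by
    rw [sinh_eq, cosh_eq, exp_neg, exp_log hE0]
    linear_combination (hplus - hminus) / 2
  refine ⟨log E / κ, div_pos (log_pos hE) hκ, ?_, ?_⟩
  · rw [mul_div_cancel₀ _ hκ.ne', hA, mul_pow, mul_pow, hε]
    field_simp
  · rw [mul_div_cancel₀ _ hκ.ne', hA, hB]
    field_simp
    linear_combination -hε

/-- The derivative of the hyperbolic profile. -/
lemma hasDerivAt_hyperbolic_profile {a b κ : ℝ} (hκ : κ ≠ 0) (s : ℝ) :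
    HasDerivAt
      (fun t => (1 / κ ^ 2) * (a * Real.sinh (κ * t) + b * Real.cosh (κ * t)) ^ 2)
      (2 / κ * ((a * Real.sinh (κ * s) + b * Real.cosh (κ * s)) *
        (a * Real.cosh (κ * s) + b * Real.sinh (κ * s)))) s := by
  have hlin : HasDerivAt (fun t => κ * t) κ s := by simpa using (hasDerivAt_id s).const_mul κ
  have hderiv :=
    (((hlin.sinh.const_mul a).add (hlin.cosh.const_mul b)).pow 2).const_mul (1 / κ ^ 2)
  refine hderiv.congr_deriv ?_
  simp only [Pi.add_apply]
  field_simp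
  norm_num
  ring

/-- The derivative of the exponential profile. -/
lemma hasDerivAt_exp_profile {ℓ : ℝ} (hℓ : ℓ ≠ 0) (τ : ℝ) :
    HasDerivAt (fun t => (Real.exp (ℓ * t) - 1) / ℓ) (Real.exp (ℓ * τ)) τ := by
  have hlin : HasDerivAt (fun t => ℓ * t) ℓ τ := by simpa using (hasDerivAt_id τ).const_mul ℓ
  exact ((hlin.exp.sub_const 1).div_const ℓ).congr_deriv (mul_div_cancel_right₀ _ hℓ)

/-- The gluing data exist, with positive `κ`, when the growing mode of the hyperbolic profile is
present. -/
lemma exists_gluing_data {τ a b : ℝ} (hτ : 0 < τ) (hab : a + b ≠ 0) (M : ℝ) (hM : 0 < M) :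
    ∃ L > 0, ∀ ℓ > L, ∃ κ > 0, κ ^ 2 > M ∧ ∃ s > 0,
      (Real.exp (ℓ * τ) - 1) / ℓ
        = (1 / κ ^ 2) * (a * Real.sinh (κ * s) + b * Real.cosh (κ * s)) ^ 2 ∧
      Real.exp (ℓ * τ) = 2 / κ * ((a * Real.sinh (κ * s) + b * Real.cosh (κ * s)) *
        (a * Real.cosh (κ * s) + b * Real.sinh (κ * s))) := by
  set C := M + |a ^ 2 - b ^ 2| / τ + (a + b) ^ 2 / τ with hC
  have hd : 0 ≤ |a ^ 2 - b ^ 2| / τ := by positivity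
  have hsq : 0 ≤ (a + b) ^ 2 / τ := by positivity
  have hC0 : 0 < C := by positivity
  refine ⟨4 * C + 4, by positivity, fun ℓ hℓ => ?_⟩
  have hℓ0 : 0 < ℓ := by linarith
  set G := Real.exp (ℓ * τ) with hG
  set F := (G - 1) / ℓ with hFdef
  have hG0 : 0 < G := Real.exp_pos _
  have hFτ : τ ≤ F := by
    rw [hFdef, le_div_iff₀ hℓ0]
    linarith [Real.add_one_le_exp (ℓ * τ)]
  have hF : 0 < F := by linarith
  have hGF : ℓ ≤ G / F := by
    rw [le_div_iff₀ hF, hFdef, mul_div_cancel₀ _ hℓ0.ne']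
    linarith
  have hdF : (a ^ 2 - b ^ 2) / F ≤ |a ^ 2 - b ^ 2| / τ :=
    div_le_div₀ (abs_nonneg _) (le_abs_self _) hτ hFτ
  set K := (G / F) ^ 2 / 4 - (a ^ 2 - b ^ 2) / F with hK
  have hKlarge : M + (a + b) ^ 2 / τ < K := by nlinarith
  have hK0 : 0 < K := by linarith
  have hsqrt : √K ^ 2 = K := Real.sq_sqrt hK0.le
  refine ⟨√K, Real.sqrt_pos.2 hK0, by rw [hsqrt]; linarith, ?_⟩
  refine exists_pos_hyperbolic_profile_eq hab hF hG0 (Real.sqrt_pos.2 hK0) ?_ ?_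
  · rw [hsqrt, hK]
    field_simp
    ring
  · rw [hsqrt]
    have : (a + b) ^ 2 / τ < K := by linarith
    rw [div_lt_iff₀ hτ] at this
    nlinarith


/-- Lemma C.1 (C¹-gluing for functions of special type): with `f_ℓ(t) = (e^{ℓt} − 1)/ℓ` and
`u_κ(t) = (1/κ²)(a sinh(κt) + b cosh(κt))²`, for every `M > 0` there is `L > 0` such that
for every `ℓ > L` there are `κ` with `κ² > M` and `r > −τ` with
`f_ℓ(τ) = u_κ(τ + r)` and `f_ℓ'(τ) = u_κ'(τ + r)`. -/
theorem c1_gluing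
    (τ : ℝ) (hτ : 0 < τ) (a b : ℝ) (hab : a ^ 2 + b ^ 2 ≠ 0) (M : ℝ) (hM : 0 < M) :
    ∃ L > 0, ∀ ℓ > L, ∃ κ : ℝ, κ ^ 2 > M ∧ ∃ r : ℝ, r > -τ ∧
      (Real.exp (ℓ * τ) - 1) / ℓ
        = (1 / κ ^ 2) * (a * Real.sinh (κ * (τ + r)) + b * Real.cosh (κ * (τ + r))) ^ 2 ∧
      deriv (fun t => (Real.exp (ℓ * t) - 1) / ℓ) τ
        = deriv (fun t => (1 / κ ^ 2) * (a * Real.sinh (κ * t) + b * Real.cosh (κ * t)) ^ 2)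
            (τ + r) := by
  by_cases h : a + b = 0
  · have h' : -a + b ≠ 0 := fun h' => hab (by
      rw [show a = 0 by linarith, show b = 0 by linarith]; norm_num)
    obtain ⟨L, hL, H⟩ := exists_gluing_data hτ h' M hM
    refine ⟨L, hL, fun ℓ hℓ => ?_⟩
    obtain ⟨κ, hκ, hκM, s, hs, hval, hder⟩ := H ℓ hℓ
    refine ⟨-κ, by rwa [neg_sq], s - τ, by linarith, ?_⟩
    rw [add_sub_cancel, (hasDerivAt_exp_profile (hL.trans hℓ).ne' τ).deriv,
      (hasDerivAt_hyperbolic_profile (neg_ne_zero.2 hκ.ne') s).deriv, hval, hder]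
    simp only [neg_mul, Real.sinh_neg, Real.cosh_neg, neg_sq]
    constructor <;> ring
  · obtain ⟨L, hL, H⟩ := exists_gluing_data hτ h M hM
    refine ⟨L, hL, fun ℓ hℓ => ?_⟩
    obtain ⟨κ, hκ, hκM, s, hs, hval, hder⟩ := H ℓ hℓ
    refine ⟨κ, hκM, s - τ, by linarith, ?_⟩
    rw [add_sub_cancel, (hasDerivAt_exp_profile (hL.trans hℓ).ne' τ).deriv,
      (hasDerivAt_hyperbolic_profile hκ.ne' s).deriv]
    exact ⟨hval, hder⟩
end
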